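/- Let r ≥ 3 and let x be an element of the Artin group Art(D_r) that commutes with both s₁ and s′₁. Then for every integer m, the commutator (η_r^m, x) = η_r^m x η_r^{−m} x⁻¹ commutes with both s₁ and s′₁. -/

import Mathlib

/-- Generators of the Artin group `Art(Dₙ)` : `a = s₁`, `a' = s′₁`,
and `s i` for `2 ≤ i ≤ n − 1`. -/
inductive DGen (n : ℕ) : Type
  | a : DGen n
  | a' : DGen n
  | s : (i : ℕ) → 2 ≤ i → i ≤ n - 1 → DGen n

/-- The generator `s_i` (for `2 ≤ i ≤ n − 1`) as an element of the free group. -/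
def Dfs (n i : ℕ) : FreeGroup (DGen n) :=
  if h : 2 ≤ i ∧ i ≤ n - 1 then FreeGroup.of (DGen.s i h.1 h.2) else 1

/-- The relators of the presentation of the Artin group `Art(Dₙ)` :
`s₁s′₁ = s′₁s₁`; `s₁s₂s₁ = s₂s₁s₂`; `s′₁s₂s′₁ = s₂s′₁s₂`;
`sᵢs_{i+1}sᵢ = s_{i+1}sᵢs_{i+1}` for `2 ≤ i ≤ n−2`;
`sᵢsⱼ = sⱼsᵢ` for `i, j ≥ 2` with `|i−j| ≥ 2`; and
`s₁sⱼ = sⱼs₁`, `s′₁sⱼ = sⱼs′₁` for `j ≥ 3`. -/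
def DRels (n : ℕ) : Set (FreeGroup (DGen n)) :=
  {r | r = FreeGroup.of DGen.a * FreeGroup.of DGen.a' *
          (FreeGroup.of DGen.a' * FreeGroup.of DGen.a)⁻¹ ∨
       r = FreeGroup.of DGen.a * Dfs n 2 * FreeGroup.of DGen.a *
          (Dfs n 2 * FreeGroup.of DGen.a * Dfs n 2)⁻¹ ∨
       r = FreeGroup.of DGen.a' * Dfs n 2 * FreeGroup.of DGen.a' *
          (Dfs n 2 * FreeGroup.of DGen.a' * Dfs n 2)⁻¹ ∨
       (∃ i : ℕ, 2 ≤ i ∧ i ≤ n - 2 ∧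
          r = Dfs n i * Dfs n (i + 1) * Dfs n i *
            (Dfs n (i + 1) * Dfs n i * Dfs n (i + 1))⁻¹) ∨
       (∃ i j : ℕ, 2 ≤ i ∧ i + 2 ≤ j ∧ j ≤ n - 1 ∧
          r = Dfs n i * Dfs n j * (Dfs n j * Dfs n i)⁻¹) ∨
       (∃ j : ℕ, 3 ≤ j ∧ j ≤ n - 1 ∧
          r = FreeGroup.of DGen.a * Dfs n j * (Dfs n j * FreeGroup.of DGen.a)⁻¹) ∨
       (∃ j : ℕ, 3 ≤ j ∧ j ≤ n - 1 ∧
          r = FreeGroup.of DGen.a' * Dfs n j * (Dfs n j * FreeGroup.of DGen.a')⁻¹)}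

/-- The Artin group of type `Dₙ`. -/
abbrev ArtinD (n : ℕ) : Type := PresentedGroup (DRels n)

/-- The generator `s₁` of `Art(Dₙ)`. -/
def Ds1 (n : ℕ) : ArtinD n := PresentedGroup.of DGen.a

/-- The generator `s′₁` of `Art(Dₙ)`. -/
def Ds1' (n : ℕ) : ArtinD n := PresentedGroup.of DGen.a'

/-- The generator `sᵢ` (for `2 ≤ i ≤ n − 1`) of `Art(Dₙ)`. -/
def Ds (n i : ℕ) : ArtinD n :=
  if h : 2 ≤ i ∧ i ≤ n - 1 then PresentedGroup.of (DGen.s i h.1 h.2) else 1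

/-- The element `w_r = s₁s′₁s₂⋯s_r` of `Art(Dₙ)` (for `2 ≤ r ≤ n − 1`). -/
def Dw (n r : ℕ) : ArtinD n :=
  Ds1 n * Ds1' n * ((List.range (r - 1)).map (fun k => Ds n (k + 2))).prod

/-- The Garside element `Δ_r = w_r^{r−1}` of `Art(Dₙ)`. -/
def DDelta (n r : ℕ) : ArtinD n := Dw n r ^ (r - 1)

/-- The element `η_r = s_{r−1}⋯s₂s₁s′₁s₂⋯s_{r−1}` of `Art(Dₙ)`. -/
def Deta (n r : ℕ) : ArtinD n :=
  ((List.range (r - 2)).reverse.map (fun k => Ds n (k + 2))).prod *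
    (Ds1 n * Ds1' n) *
    ((List.range (r - 2)).map (fun k => Ds n (k + 2))).prod

theorem PresentedGroup.mk_Dfs (n i : ℕ) : PresentedGroup.mk (DRels n) (Dfs n i) = Ds n i := by
  unfold Dfs Ds
  split_ifs
  · rfl
  · exact map_one _

theorem ArtinD.mk_eq_mk_of_mem {n : ℕ} {u v : FreeGroup (DGen n)} (h : u * v⁻¹ ∈ DRels n) :
    PresentedGroup.mk (DRels n) u = PresentedGroup.mk (DRels n) v := by
  have := PresentedGroup.one_of_mem h
  rwa [map_mul, map_inv, mul_inv_eq_one] at this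

theorem Ds1_mul_Ds1' (n : ℕ) : Ds1 n * Ds1' n = Ds1' n * Ds1 n :=
  ArtinD.mk_eq_mk_of_mem (Or.inl rfl)

theorem Ds1_braid (n : ℕ) : Ds1 n * Ds n 2 * Ds1 n = Ds n 2 * Ds1 n * Ds n 2 := by
  have h := ArtinD.mk_eq_mk_of_mem (n := n) (Or.inr (Or.inl rfl))
  simp only [map_mul, PresentedGroup.mk_Dfs] at h
  exact h

theorem Ds1'_braid (n : ℕ) : Ds1' n * Ds n 2 * Ds1' n = Ds n 2 * Ds1' n * Ds n 2 := by
  have h := ArtinD.mk_eq_mk_of_mem (n := n) (Or.inr (Or.inr (Or.inl rfl)))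
  simp only [map_mul, PresentedGroup.mk_Dfs] at h
  exact h

theorem commute_Ds1_Ds {n j : ℕ} (hj : 3 ≤ j) : Commute (Ds1 n) (Ds n j) := by
  by_cases hn : j ≤ n - 1
  · have := ArtinD.mk_eq_mk_of_mem (n := n)
      (Or.inr (Or.inr (Or.inr (Or.inr (Or.inr (Or.inl ⟨j, hj, hn, rfl⟩))))))
    simp only [map_mul, PresentedGroup.mk_Dfs] at this
    exact this
  · simp [Ds, hn]

theorem commute_Ds1'_Ds {n j : ℕ} (hj : 3 ≤ j) : Commute (Ds1' n) (Ds n j) := by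
  by_cases hn : j ≤ n - 1
  · have := ArtinD.mk_eq_mk_of_mem (n := n)
      (Or.inr (Or.inr (Or.inr (Or.inr (Or.inr (Or.inr ⟨j, hj, hn, rfl⟩))))))
    simp only [map_mul, PresentedGroup.mk_Dfs] at this
    exact this
  · simp [Ds, hn]

/-- If `a` and `b` commute and each of them braids with `s`, then `s a b s` carries `a` to `b`. -/
theorem semiconjBy_of_braid {M : Type*} [Monoid M] {a b s : M} (hab : Commute a b)
    (ha : a * s * a = s * a * s) (hb : b * s * b = s * b * s) :
    SemiconjBy (s * (a * b) * s) a b :=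
  calc s * (a * b) * s * a = s * b * (a * s * a) := by simp only [hab.eq, mul_assoc]
    _ = s * b * s * a * s := by simp only [ha, mul_assoc]
    _ = b * s * (b * a) * s := by simp only [← hb, mul_assoc]
    _ = b * (s * (a * b) * s) := by simp only [hab.eq, mul_assoc]

theorem Deta_add_three (n k : ℕ) : Deta n (k + 3) =
    ((List.range k).reverse.map (fun i => Ds n (i + 3))).prod *
      (Ds n 2 * (Ds1 n * Ds1' n) * Ds n 2) *
      ((List.range k).map (fun i => Ds n (i + 3))).prod := by
  simp [Deta, List.range_succ_eq_map, ← List.map_reverse, Function.comp_def, mul_assoc]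

theorem SemiconjBy.Deta_of_commute {n k : ℕ} {a b : ArtinD n}
    (h : SemiconjBy (Ds n 2 * (Ds1 n * Ds1' n) * Ds n 2) a b)
    (ha : ∀ i, Commute a (Ds n (i + 3))) (hb : ∀ i, Commute b (Ds n (i + 3))) :
    SemiconjBy (Deta n (k + 3)) a b := by
  rw [Deta_add_three]
  refine SemiconjBy.mul_left (SemiconjBy.mul_left ?_ h) ?_
  · exact (Commute.list_prod_right _ _ (by simpa using fun i _ => hb i)).symm
  · exact (Commute.list_prod_right _ _ (by simpa using fun i _ => ha i)).symm

theorem semiconjBy_Deta_Ds1 {n r : ℕ} (hr : 3 ≤ r) :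
    SemiconjBy (Deta n r) (Ds1 n) (Ds1' n) := by
  obtain ⟨k, rfl⟩ := Nat.exists_eq_add_of_le' hr
  exact (semiconjBy_of_braid (Ds1_mul_Ds1' n) (Ds1_braid n) (Ds1'_braid n)).Deta_of_commute
    (fun i => commute_Ds1_Ds (by lia)) (fun i => commute_Ds1'_Ds (by lia))

theorem semiconjBy_Deta_Ds1' {n r : ℕ} (hr : 3 ≤ r) :
    SemiconjBy (Deta n r) (Ds1' n) (Ds1 n) := by
  obtain ⟨k, rfl⟩ := Nat.exists_eq_add_of_le' hr
  have h := semiconjBy_of_braid (Ds1_mul_Ds1' n).symm (Ds1'_braid n) (Ds1_braid n)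
  rw [← Ds1_mul_Ds1'] at h
  exact h.Deta_of_commute
    (fun i => commute_Ds1'_Ds (by lia)) (fun i => commute_Ds1_Ds (by lia))

theorem Subgroup.mem_normalizer_centralizer_pair {G : Type*} [Group G] {g a b : G}
    (hab : SemiconjBy g a b) (hba : SemiconjBy g b a) :
    g ∈ Subgroup.normalizer (Subgroup.centralizer {a, b} : Set G) := by
  rw [Subgroup.mem_normalizer_iff]
  intro h
  have hb : b = g * a * g⁻¹ := by rw [hab.eq, mul_inv_cancel_right]
  have ha : a = g * b * g⁻¹ := by rw [hba.eq, mul_inv_cancel_right]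
  have hcb : Commute b (g * h * g⁻¹) ↔ Commute a h := by
    conv_lhs => rw [hb, Commute.conj_iff]
  have hca : Commute a (g * h * g⁻¹) ↔ Commute b h := by
    conv_lhs => rw [ha, Commute.conj_iff]
  simp only [Subgroup.mem_centralizer_iff, Set.mem_insert_iff, Set.mem_singleton_iff,
    forall_eq_or_imp, forall_eq]
  exact and_comm.trans (and_congr hca.symm hcb.symm)

/-- Let `r ≥ 3` and let `x ∈ Art(D_r)` commute with both `s₁` and `s′₁`.
Then for every integer `m`, the commutator `(η_r^m, x) = η_r^m x η_r^{−m} x⁻¹` commutes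
with both `s₁` and `s′₁`. -/
theorem ArtinD_commutator_eta_centralizes (r : ℕ) (hr : 3 ≤ r) (x : ArtinD r)
    (hx1 : x * Ds1 r = Ds1 r * x) (hx1' : x * Ds1' r = Ds1' r * x) (m : ℤ) :
    (Deta r r ^ m * x * Deta r r ^ (-m) * x⁻¹) * Ds1 r =
      Ds1 r * (Deta r r ^ m * x * Deta r r ^ (-m) * x⁻¹) ∧
    (Deta r r ^ m * x * Deta r r ^ (-m) * x⁻¹) * Ds1' r =
      Ds1' r * (Deta r r ^ m * x * Deta r r ^ (-m) * x⁻¹) := by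
  have hx : x ∈ Subgroup.centralizer {Ds1 r, Ds1' r} := by
    simp [Subgroup.mem_centralizer_iff, hx1, hx1']
  have hη := zpow_mem (Subgroup.mem_normalizer_centralizer_pair
    (semiconjBy_Deta_Ds1 (n := r) hr) (semiconjBy_Deta_Ds1' hr)) m
  have h := mul_mem ((Subgroup.mem_normalizer_iff.1 hη x).1 hx) (inv_mem hx)
  rw [← zpow_neg, Subgroup.mem_centralizer_iff] at h
  exact ⟨(h _ (by simp)).symm, (h _ (by simp)).symm⟩
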